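/- arXiv:2201.05813 — 2 statements merged into one kernel-verified Lean document; each statement's English description precedes it below -/
import Mathlib

section
/- Let R = R_1 × … × R_ℓ be a finite principal ideal ring, i.e. a product of finite chain rings, with Jacobson radical J, and let C ⊆ R^n be an R-linear code. Then M(C) = M(0:_C J). -/
/-- Least cardinality of a system of generators of a submodule (`μ`), with `μ(0)=0`. -/
noncomputable def mu (R : Type*) {M : Type*} [Semiring R] [AddCommMonoid M] [Module R M]
    (D : Submodule R M) : ℕ :=
  sInf {k | ∃ s : Finset M, s.card = k ∧ Submodule.span R (s : Set M) = D}

/-- `G` is a minimal system of generators of the submodule `D`. -/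
def IsMinGenSet (R : Type*) {M : Type*} [Semiring R] [AddCommMonoid M] [Module R M]
    (G : Set M) (D : Submodule R M) : Prop :=
  Submodule.span R G = D ∧ ∀ G' ⊆ G, Submodule.span R G' = D → G' = G

/-- The socle `0 :_C J`, where `J` is the Jacobson radical of `R`. -/
noncomputable def socJ {R M : Type*} [CommRing R] [AddCommGroup M] [Module R M]
    (C : Submodule R M) : Submodule R M :=
  C ⊓ ⨅ r ∈ (⊥ : Ideal R).jacobson, LinearMap.ker (LinearMap.lsmul R M r)

/-- `D ∈ 𝒮_j(C)`: `D` is a subcode of `C` having a minimal system of generators of card `j`. -/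
def memS {R M : Type*} [Semiring R] [AddCommMonoid M] [Module R M]
    (j : ℕ) (C D : Submodule R M) : Prop :=
  D ≤ C ∧ ∃ G : Finset M, G.card = j ∧ IsMinGenSet R (↑G : Set M) D

/-- The (componentwise) support of a set of vectors. -/
noncomputable def suppOf {M : Type*} {u : ℕ} (σ : M → Fin u → ℕ) (D : Set M) : Fin u → ℕ :=
  fun i => sSup ((fun v => σ v i) '' D)

/-- The `r`-th generalized weight `d_r(C)`. -/
noncomputable def dGW {R M : Type*} [Semiring R] [AddCommMonoid M] [Module R M] {u : ℕ}
    (σ : M → Fin u → ℕ) (r : ℕ) (C : Submodule R M) : ℕ :=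
  sInf {w | ∃ j, r ≤ j ∧ ∃ D : Submodule R M, memS j C D ∧ w = ∑ i, suppOf σ (D : Set M) i}

/-- `σ` is a support on `R^n`: (P1), (P2), (P3). -/
def IsSupport {R : Type*} [CommRing R] {n u : ℕ} (σ : (Fin n → R) → Fin u → ℕ) : Prop :=
  (∀ v, σ v = 0 ↔ v = 0) ∧ (∀ (r : R) (v), σ (r • v) ≤ σ v) ∧ (∀ v w, σ (v + w) ≤ σ v ⊔ σ w)

/-- `σ` is modular: property (P⋆). -/
def IsModular {R : Type*} [CommRing R] {n u : ℕ} (σ : (Fin n → R) → Fin u → ℕ) : Prop :=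
  ∀ v w (i : Fin u), σ v i ≠ 0 → σ v i ≤ σ w i → ∃ r : R, σ (v + r • w) i < σ v i

/-- The set of minimal (support) elements of a set `S` w.r.t. `σ`. -/
def MinSet {M : Type*} [Zero M] {u : ℕ} (σ : M → Fin u → ℕ) (S : Set M) : Set M :=
  {v | v ∈ S ∧ v ≠ 0 ∧ ∀ w ∈ S, w ≠ 0 → σ w ≤ σ v → σ w = σ v}

/-- The `j`-th projected code `C_j ⊆ R_j^n`. -/
noncomputable def projCode {ℓ n : ℕ} {Rj : Fin ℓ → Type*} [∀ j, CommRing (Rj j)]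
    (C : Submodule (∀ j, Rj j) (Fin n → ∀ j, Rj j)) (j : Fin ℓ) :
    Submodule (Rj j) (Fin n → Rj j) :=
  Submodule.span (Rj j) {w | ∃ v ∈ C, w = fun i => v i j}

/-- `M(C) = μ(C_1) + ⋯ + μ(C_ℓ)`. -/
noncomputable def Mnum {ℓ n : ℕ} {Rj : Fin ℓ → Type*} [∀ j, CommRing (Rj j)]
    (C : Submodule (∀ j, Rj j) (Fin n → ∀ j, Rj j)) : ℕ :=
  ∑ j, mu (Rj j) (projCode C j)

theorem mu_eq_spanFinrank {R M : Type*} [CommRing R] [AddCommGroup M] [Module R M]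
    (D : Submodule R M) (h : D.FG) : mu R D = D.spanFinrank := by
  apply le_antisymm
  · exact Nat.sInf_le h.exists_span_finset_card_eq_spanFinrank
  · have hne : {k | ∃ s : Finset M, s.card = k ∧ Submodule.span R (s : Set M) = D}.Nonempty :=
      ⟨_, h.exists_span_finset_card_eq_spanFinrank⟩
    obtain ⟨s, hs, hD⟩ := Nat.sInf_mem hne
    unfold mu
    rw [← hs]
    conv_lhs => rw [← hD]
    simpa using Submodule.spanFinrank_span_le_ncard_of_finite (R := R) s.finite_toSet

theorem card_quot_eq {R M : Type*} [CommRing R] [AddCommGroup M] [Module R M] [IsLocalRing R]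
    [Finite R] [Finite M] (D : Submodule R M) :
    Nat.card (D ⧸ (IsLocalRing.maximalIdeal R) • (⊤ : Submodule R D)) =
      Nat.card (R ⧸ IsLocalRing.maximalIdeal R) ^ mu R D := by
  have hfg : D.FG := Module.Finite.iff_fg.mp inferInstance
  rw [mu_eq_spanFinrank D hfg, IsLocalRing.spanFinrank_eq_finrank_quotient D hfg]
  let _ : Field (R ⧸ IsLocalRing.maximalIdeal R) := Ideal.Quotient.field _
  exact Module.natCard_eq_pow_finrank

theorem mu_eq_of_socle {R M : Type*} [CommRing R] [AddCommGroup M] [Module R M] [IsLocalRing R]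
    [Finite R] [Finite M] [IsPrincipalIdealRing R] (D S : Submodule R M)
    (hS : ∀ w, w ∈ S ↔ w ∈ D ∧ ∀ t ∈ IsLocalRing.maximalIdeal R, t • w = 0) :
    mu R D = mu R S := by
  have hfin : Finite (R ⧸ IsLocalRing.maximalIdeal R) :=
    Finite.of_surjective _ Ideal.Quotient.mk_surjective
  have hq : 1 < Nat.card (R ⧸ IsLocalRing.maximalIdeal R) := Finite.one_lt_card
  apply Nat.pow_right_injective hq
  show _ ^ _ = _ ^ _
  rw [← card_quot_eq, ← card_quot_eq]
  obtain ⟨t, ht⟩ := (IsPrincipalIdealRing.principal (IsLocalRing.maximalIdeal R)).principal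
  have htm : t ∈ IsLocalRing.maximalIdeal R := ht ▸ Submodule.mem_span_singleton_self t
  let f : D →ₗ[R] D := LinearMap.lsmul R D t
  have h1 : (IsLocalRing.maximalIdeal R) • (⊤ : Submodule R D) = LinearMap.range f := by
    rw [ht, LinearMap.range_eq_map]
    exact Submodule.ideal_span_singleton_smul t ⊤
  have h2 : (IsLocalRing.maximalIdeal R) • (⊤ : Submodule R S) = ⊥ := by
    rw [eq_bot_iff, Submodule.smul_le]
    intro r hr x _
    rw [Submodule.mem_bot]
    exact Subtype.ext (((hS x).1 x.2).2 r hr)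
  have h3 : Nat.card (LinearMap.ker f) = Nat.card S := by
    refine Nat.card_congr ⟨fun x => ⟨x.1.1, (hS _).2 ⟨x.1.2, fun r hr => ?_⟩⟩,
      fun x => ⟨⟨x.1, ((hS _).1 x.2).1⟩, ?_⟩, fun x => rfl, fun x => rfl⟩
    · rw [ht] at hr
      obtain ⟨a, rfl⟩ := Submodule.mem_span_singleton.1 hr
      have h := congrArg Subtype.val (LinearMap.mem_ker.1 x.2)
      have h' : t • (x.1.1 : M) = 0 := h
      rw [smul_assoc, h', smul_zero]
    · rw [LinearMap.mem_ker]
      exact Subtype.ext (((hS x).1 x.2).2 t htm)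
  rw [h1, h2]
  have e1 : Nat.card (S ⧸ (⊥ : Submodule R S)) = Nat.card S :=
    Nat.card_congr (Submodule.quotEquivOfEqBot _ rfl).toEquiv
  have e2 := Submodule.card_eq_card_quotient_mul_card (LinearMap.range f)
  have e3 := Submodule.card_eq_card_quotient_mul_card (LinearMap.ker f)
  have e4 : Nat.card (D ⧸ LinearMap.ker f) = Nat.card (LinearMap.range f) :=
    Nat.card_congr f.quotKerEquivRange.toEquiv
  rw [e1, ← h3]
  have hp : 0 < Nat.card (LinearMap.range f) := Nat.card_pos
  rw [e4] at e3
  apply Nat.eq_of_mul_eq_mul_left hp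
  first | linarith | nlinarith

theorem mem_jac_pi {ℓ : ℕ} {Rj : Fin ℓ → Type*} [∀ j, CommRing (Rj j)] [∀ j, IsLocalRing (Rj j)]
    (r : ∀ j, Rj j) : r ∈ (⊥ : Ideal (∀ j, Rj j)).jacobson ↔
      ∀ j, r j ∈ IsLocalRing.maximalIdeal (Rj j) := by
  rw [Ideal.mem_jacobson_bot]
  constructor
  · intro h j
    rw [IsLocalRing.mem_maximalIdeal, mem_nonunits_iff]
    rintro ⟨u, hu⟩
    have := Pi.isUnit_iff.1 (h (Pi.single j (-(↑u⁻¹ : Rj j)))) j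
    simp [← hu] at this
  · intro h y
    rw [Pi.isUnit_iff]
    intro j
    have hj : r j ∈ (⊥ : Ideal (Rj j)).jacobson := by
      rw [IsLocalRing.jacobson_eq_maximalIdeal _ bot_ne_top]; exact h j
    exact Ideal.mem_jacobson_bot.1 hj (y j)

theorem mem_projCode {ℓ n : ℕ} {Rj : Fin ℓ → Type*} [∀ j, CommRing (Rj j)]
    (C : Submodule (∀ j, Rj j) (Fin n → ∀ j, Rj j)) (j : Fin ℓ) (w : Fin n → Rj j) :
    w ∈ projCode C j ↔ ∃ v ∈ C, w = fun i => v i j := by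
  constructor
  · intro h
    unfold projCode at h
    induction h using Submodule.span_induction with
    | mem x hx => exact hx
    | zero => exact ⟨0, C.zero_mem, rfl⟩
    | add x y _ _ hx hy =>
      obtain ⟨v, hv, rfl⟩ := hx
      obtain ⟨u, hu, rfl⟩ := hy
      exact ⟨v + u, C.add_mem hv hu, rfl⟩
    | smul a x _ hx =>
      obtain ⟨v, hv, rfl⟩ := hx
      refine ⟨(Pi.single j a : ∀ j, Rj j) • v, C.smul_mem _ hv, ?_⟩
      funext i
      simp
  · exact fun h => Submodule.subset_span h

theorem mem_socJ {R M : Type*} [CommRing R] [AddCommGroup M] [Module R M]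
    (C : Submodule R M) (v : M) :
    v ∈ socJ C ↔ v ∈ C ∧ ∀ r ∈ (⊥ : Ideal R).jacobson, r • v = 0 := by
  simp [socJ, Submodule.mem_iInf]

/-- Proposition `ann`: over a finite principal ideal ring
`R = R_1 × … × R_ℓ` (a product of finite chain rings) with Jacobson radical `J`,
every code `C ⊆ R^n` satisfies `M(C) = M(0:_C J)`. -/
theorem stmt_2 {ℓ n : ℕ} {Rj : Fin ℓ → Type*} [∀ j, CommRing (Rj j)] [∀ j, Fintype (Rj j)]
    [∀ j, IsLocalRing (Rj j)] [∀ j, IsPrincipalIdealRing (Rj j)]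
    (C : Submodule (∀ j, Rj j) (Fin n → ∀ j, Rj j)) :
    Mnum C = Mnum (socJ C) := by

  unfold Mnum
  refine Finset.sum_congr rfl fun j _ => mu_eq_of_socle _ _ fun w => ?_
  rw [mem_projCode, mem_projCode]
  constructor
  · rintro ⟨v, hv, rfl⟩
    rw [mem_socJ] at hv
    refine ⟨⟨v, hv.1, rfl⟩, fun t ht => ?_⟩
    have hJ : (Pi.single j t : ∀ j, Rj j) ∈ (⊥ : Ideal (∀ j, Rj j)).jacobson := by
      rw [mem_jac_pi]
      intro k
      by_cases hk : k = j
      · subst hk; simpa using ht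
      · simp [Pi.single_eq_of_ne hk]
    have h := hv.2 _ hJ
    funext i
    have h' := congrFun (congrFun h i) j
    simpa using h'
  · rintro ⟨⟨v, hv, rfl⟩, h⟩
    refine ⟨(Pi.single j 1 : ∀ j, Rj j) • v, ?_, ?_⟩
    · rw [mem_socJ]
      refine ⟨C.smul_mem _ hv, fun r hr => ?_⟩
      have h' := h (r j) ((mem_jac_pi r).1 hr j)
      funext i k
      by_cases hk : k = j
      · subst hk; simpa using congrFun h' i
      · simp [Pi.single_eq_of_ne hk]
    · funext i
      simp
end

section
/- Let R be a finite commutative ring, let σ : R^n → ℕ^u be a modular support, and let C ⊆ R^n be an R-linear code. If v, w ∈ Min(C) are minimal codewords with σ(v) = σ(w), then v = r•w for some unit r ∈ R. -/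
theorem aux_idem {R : Type*} [CommRing R] [Finite R] (r : R) :
    ∃ k : ℕ, r ^ (k + 1) * r ^ (k + 1) = r ^ (k + 1) := by
  have key : ∃ a b : ℕ, a < b ∧ r ^ a = r ^ b := by
    obtain ⟨a, b, hab, h⟩ := Finite.exists_ne_map_eq_of_infinite (fun m : ℕ => r ^ m)
    rcases lt_or_gt_of_ne hab with h1 | h1
    · exact ⟨a, b, h1, h⟩
    · exact ⟨b, a, h1, h.symm⟩
  obtain ⟨a, b, hab, h⟩ := key
  obtain ⟨d, rfl⟩ := Nat.exists_eq_add_of_lt hab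
  have h2 : ∀ m : ℕ, r ^ a * r ^ (m * (d + 1)) = r ^ a := by
    intro m
    induction m with
    | zero => simp
    | succ m ih =>
      have e : r ^ a * r ^ ((m + 1) * (d + 1)) = r ^ (a + d + 1) * r ^ (m * (d + 1)) := by ring
      rw [e, ← h, ih]
  refine ⟨a * (d + 1) + d, ?_⟩
  have e1 : a * (d + 1) + d + 1 = a + (a * d + d + 1) := by ring
  have e2 : a * (d + 1) + d + 1 = (a + 1) * (d + 1) := by ring
  have h3 := h2 (a + 1)
  calc r ^ (a * (d + 1) + d + 1) * r ^ (a * (d + 1) + d + 1)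
      = r ^ (a + (a * d + d + 1)) * r ^ ((a + 1) * (d + 1)) := by rw [← e1, ← e2]
    _ = (r ^ a * r ^ ((a + 1) * (d + 1))) * r ^ (a * d + d + 1) := by rw [pow_add]; ring
    _ = r ^ (a * (d + 1) + d + 1) := by rw [h3, e1, pow_add r a]

theorem aux_unit {R M : Type*} [CommRing R] [Finite R] [AddCommGroup M] [Module R M]
    (r s : R) (w : M) (h : s • r • w = w) : ∃ t : R, IsUnit t ∧ t • w = r • w := by
  obtain ⟨k, hk⟩ := aux_idem r
  have h1 : ∀ m : ℕ, (s ^ m * r ^ m) • w = w := by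
    intro m
    induction m with
    | zero => simp
    | succ m ih =>
      have e : s ^ (m + 1) * r ^ (m + 1) = (s ^ m * r ^ m) * (s * r) := by ring
      rw [e, mul_smul, mul_smul s r, h, ih]
  have h2 : r ^ (k + 1) • w = w := by
    conv_lhs => rw [← h1 (k + 1)]
    rw [← mul_smul, show r ^ (k + 1) * (s ^ (k + 1) * r ^ (k + 1))
      = s ^ (k + 1) * (r ^ (k + 1) * r ^ (k + 1)) by ring, hk, h1]
  refine ⟨r * r ^ (k + 1) + (1 - r ^ (k + 1)), ?_, ?_⟩
  · refine IsUnit.of_mul_eq_one (r ^ k * r ^ (k + 1) + (1 - r ^ (k + 1))) ?_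
    have e0 : r * r ^ k = r ^ (k + 1) := by ring
    generalize r ^ (k + 1) = e at *
    linear_combination (e * e) * e0 + (e - r - r ^ k + 2) * hk
  · rw [add_smul, sub_smul, one_smul, mul_smul, h2, sub_self, add_zero]

theorem aux_mul {R : Type*} [CommRing R] {n u : ℕ}
    (σ : (Fin n → R) → Fin u → ℕ) (hσ : IsSupport σ) (hmod : IsModular σ)
    (C : Submodule R (Fin n → R))
    (v w : Fin n → R) (hv : v ∈ MinSet σ (C : Set (Fin n → R)))
    (hw : w ∈ MinSet σ (C : Set (Fin n → R))) (hvw : σ v = σ w) :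
    ∃ r : R, v = r • w := by
  obtain ⟨hvC, hv0, hvm⟩ := hv
  have h0 : σ v ≠ 0 := fun h => hv0 ((hσ.1 v).1 h)
  obtain ⟨i, hi⟩ := Function.ne_iff.1 h0
  obtain ⟨r, hr⟩ := hmod v w i hi (by rw [hvw])
  refine ⟨-r, ?_⟩
  by_contra hne
  have hz : v + r • w ≠ 0 := fun h => hne (by rw [neg_smul]; exact eq_neg_of_add_eq_zero_left h)
  have hle : σ (v + r • w) ≤ σ v :=
    (hσ.2.2 _ _).trans (sup_le le_rfl (hvw ▸ hσ.2.1 r w))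
  have := hvm _ (C.add_mem hvC (C.smul_mem r hw.1)) hz hle
  rw [this] at hr
  exact lt_irrefl _ hr

/-- Theorem `lemma:minsupp`(3): for a modular support `σ` over a finite
commutative ring `R` and a code `C ⊆ R^n`, any two minimal codewords `v, w ∈ Min(C)` with
`σ(v) = σ(w)` satisfy `v = r • w` for some unit `r ∈ R`. -/
theorem stmt_9 {R : Type*} [CommRing R] [Fintype R] [Nontrivial R] {n u : ℕ}
    (σ : (Fin n → R) → Fin u → ℕ) (hσ : IsSupport σ) (hmod : IsModular σ)
    (C : Submodule R (Fin n → R))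
    (v w : Fin n → R) (hv : v ∈ MinSet σ (C : Set (Fin n → R)))
    (hw : w ∈ MinSet σ (C : Set (Fin n → R))) (hvw : σ v = σ w) :
    ∃ r : R, IsUnit r ∧ v = r • w := by
  obtain ⟨r, hr⟩ := aux_mul σ hσ hmod C v w hv hw hvw
  obtain ⟨s, hs⟩ := aux_mul σ hσ hmod C w v hw hv hvw.symm
  obtain ⟨t, ht, h⟩ := aux_unit r s w (by rw [← hr, ← hs])
  exact ⟨t, ht, by rw [h, hr]⟩
end
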